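/- arXiv:1510.01574 — 2 statements merged into one kernel-verified Lean document; each statement's English description precedes it below -/
import Mathlib

section
/- Let S = (A,I,R) be a (1,3)-CSSH circular splicing system. Then the flat splicing system S' = (A, Y, R'), where Y = Lin(I) and R' = {(a,1,1,b) : (a,b) ∈ R}, satisfies L(S') = Lin(L(S)). Conversely, let S' = (A, Y, R') be a flat splicing system where Y ⊆ A^+ is a finite language closed under the conjugacy relation, R' = {(a,1,1,b) : (a,b) ∈ R} and R is a symmetric relation on A; then, letting I = ~Y be the circularization of Y, the (1,3)-CSSH system S = (A,I,R) satisfies L(S') = Lin(L(S)). -/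
/-- Conjugacy of words: `w` and `w'` are conjugate iff `w = x ++ y` and `w' = y ++ x`. -/
def WordConj {A : Type*} (w w' : List A) : Prop :=
  ∃ x y : List A, w = x ++ y ∧ w' = y ++ x

/-- A flat splicing rule `(α, β, γ, δ)`; its components are called handles. -/
structure FlatRule (A : Type*) where
  α : List A
  β : List A
  γ : List A
  δ : List A

/-- One flat splicing step: applying the rule `(α,β,γ,δ)` to `u = xαβy` and
`v = γzδ` produces `w = xαγzδβy`. -/
def FlatStep {A : Type*} (R : Set (FlatRule A)) (L : Set (List A)) (w : List A) : Prop :=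
  ∃ r ∈ R, ∃ x y z : List A,
    x ++ r.α ++ r.β ++ y ∈ L ∧ r.γ ++ z ++ r.δ ∈ L ∧
    w = x ++ r.α ++ r.γ ++ z ++ r.δ ++ r.β ++ y

/-- The language generated by the flat splicing system `(A, I, R)`: the smallest
language containing `I` and closed under all productions by rules of `R`. -/
def FlatLang {A : Type*} (I : Set (List A)) (R : Set (FlatRule A)) : Set (List A) :=
  ⋂₀ {L : Set (List A) | I ⊆ L ∧ ∀ w, FlatStep R L w → w ∈ L}

/-- One (1,3)-CSSH splicing step (at the level of full linearizations): the rule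
`(a, b)` (that is, `a#1$b#1`) splices circular words `~(x a)` and `~(y b)` into
`~(x a y b)`. -/
def CSSHStep {A : Type*} (R : Set (A × A)) (L : Set (List A)) (w : List A) : Prop :=
  ∃ (a b : A) (x y : List A), (a, b) ∈ R ∧ x ++ [a] ∈ L ∧ y ++ [b] ∈ L ∧
    WordConj w (x ++ [a] ++ y ++ [b])

/-- The full linearization of the circular language generated by the (1,3)-CSSH system
`(A, ~I, R)`, where `I` is a linearization of the initial circular language. -/
def CSSHLang {A : Type*} (I : Set (List A)) (R : Set (A × A)) : Set (List A) :=
  ⋂₀ {L : Set (List A) |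
      (∀ w ∈ I, ∀ w', WordConj w w' → w' ∈ L) ∧ ∀ w, CSSHStep R L w → w ∈ L}

/-- The flat rules `(a, 1, 1, b)` associated with a set `R` of pairs of letters. -/
def insRules {A : Type*} (R : Set (A × A)) : Set (FlatRule A) :=
  {r | ∃ a b : A, (a, b) ∈ R ∧ r = ⟨[a], [], [], [b]⟩}

theorem wc_iff {A : Type} (w w' : List A) : WordConj w w' ↔ w ~r w' := by
  constructor
  · rintro ⟨x, y, rfl, rfl⟩
    exact List.isRotated_append
  · rintro ⟨n, rfl⟩
    refine ⟨w.take (n % w.length), w.drop (n % w.length), by simp, ?_⟩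
    rw [List.rotate_eq_drop_append_take_mod]

theorem wc_trans {A : Type} {u v w : List A} (h : WordConj u v) (h' : WordConj v w) :
    WordConj u w := by
  rw [wc_iff] at *
  exact h.trans h'

theorem wc_symm {A : Type} {u v : List A} (h : WordConj u v) : WordConj v u := by
  obtain ⟨x, y, rfl, rfl⟩ := h
  exact ⟨y, x, rfl, rfl⟩

theorem wc_refl {A : Type} (u : List A) : WordConj u u := ⟨u, [], by simp, by simp⟩

theorem cssh_conj {A : Type} {I : Set (List A)} {R : Set (A × A)} {w w' : List A}
    (hw : w ∈ CSSHLang I R) (h : WordConj w w') : w' ∈ CSSHLang I R := by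
  intro L hL
  have := hw {v | ∀ v', WordConj v v' → v' ∈ L} ⟨?_, ?_⟩
  · exact this _ h
  · intro u hu u' huu' v hv
    exact hL.1 u hu v (wc_trans huu' hv)
  · rintro u ⟨a, b, x, y, hab, hx, hy, hc⟩ v hv
    exact hL.2 v ⟨a, b, x, y, hab, hx _ (wc_refl _), hy _ (wc_refl _),
      wc_trans (wc_symm hv) hc⟩

theorem cssh_step {A : Type} {I : Set (List A)} {R : Set (A × A)} {w : List A}
    (hw : CSSHStep R (CSSHLang I R) w) : w ∈ CSSHLang I R := by
  obtain ⟨a, b, x, y, hab, hx, hy, hc⟩ := hw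
  intro L hL
  exact hL.2 _ ⟨a, b, x, y, hab, hx L hL, hy L hL, hc⟩

theorem flat_ins {A : Type} {I : Set (List A)} {R : Set (A × A)} {a b : A} {x y z : List A}
    (hab : (a, b) ∈ R) (hu : x ++ a :: y ∈ FlatLang I (insRules R))
    (hv : z ++ [b] ∈ FlatLang I (insRules R)) :
    x ++ a :: (z ++ b :: y) ∈ FlatLang I (insRules R) := by
  intro L hL
  refine hL.2 _ ⟨_, ⟨a, b, hab, rfl⟩, x, y, z, ?_, ?_, ?_⟩
  · simpa using hu L hL
  · simpa using hv L hL
  · simp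

theorem flat_conj {A : Type} {I : Set (List A)} {R : Set (A × A)}
    (hsym : ∀ a b : A, (a, b) ∈ R → (b, a) ∈ R)
    (hI : ∀ w ∈ I, ∀ w', WordConj w w' → w' ∈ I) {w w' : List A}
    (hw : w ∈ FlatLang I (insRules R)) (h : WordConj w w') :
    w' ∈ FlatLang I (insRules R) := by
  have := hw {v | ∀ v', WordConj v v' → v' ∈ FlatLang I (insRules R)} ⟨?_, ?_⟩
  · exact this _ h
  · intro u hu v hv L hL
    exact hL.1 (hI u hu v hv)
  · rintro _ ⟨_, ⟨a, b, hab, rfl⟩, x, y, z, hu, hv, rfl⟩ v ⟨p, q, hpq, rfl⟩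
    simp only [Set.mem_setOf_eq, List.append_nil, List.nil_append] at hu hv hpq
    have h1 : y ++ x ++ [a] ∈ FlatLang I (insRules R) := hu _ ⟨x ++ [a], y, rfl, by simp⟩
    -- cut inside `z b`
    have key : ∀ c d : List A, z ++ [b] = c ++ d →
        d ++ y ++ x ++ [a] ++ c ∈ FlatLang I (insRules R) := by
      intro c d hcd
      rcases List.eq_nil_or_concat d with rfl | ⟨d', e, rfl⟩
      · have h2 := flat_ins (x := y ++ x) (y := []) hab h1 (hv _ (wc_refl _))
        simp only [List.append_nil] at hcd
        rw [← hcd]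
        simpa using h2
      · have hc := hcd
        rw [List.concat_eq_append, ← List.append_assoc] at hc
        obtain ⟨hz, hb⟩ := List.append_inj' hc rfl
        obtain rfl : b = e := by simpa using hb
        have h3 := hv _ ⟨c, d'.concat b, hcd, rfl⟩
        have h2 := flat_ins (x := d') (y := c) (z := y ++ x) (hsym _ _ hab)
          (by simpa using h3) h1
        simpa using h2
    have h4 : (x ++ [a]) ++ (z ++ [b] ++ y) = p ++ q := by simpa using hpq
    rcases List.append_eq_append_iff.1 h4 with ⟨c, rfl, hc⟩ | ⟨c, hc, rfl⟩
    · rcases List.append_eq_append_iff.1 hc with ⟨d, rfl, rfl⟩ | ⟨d, hd, rfl⟩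
      · have h5 := hu (q ++ x ++ a :: d) ⟨x ++ [a] ++ d, q, by simp, by simp⟩
        simpa using flat_ins hab h5 (hv _ (wc_refl _))
      · simpa using key c d hd
    · rcases List.eq_nil_or_concat c with rfl | ⟨c', e, rfl⟩
      · have := key [] (z ++ [b]) (by simp)
        simp only [List.append_nil] at hc
        rw [← hc]
        simpa using this
      · rw [List.concat_eq_append, ← List.append_assoc] at hc
        obtain ⟨rfl, hb⟩ := List.append_inj' hc rfl
        obtain rfl : a = e := by simpa using hb
        have h5 := hu (c' ++ a :: (y ++ p)) ⟨p, c' ++ a :: y, by simp, by simp⟩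
        simpa using flat_ins hab h5 (hv _ (wc_refl _))

theorem flat_eq {A : Type} {I : Set (List A)} {R : Set (A × A)}
    (hsym : ∀ a b : A, (a, b) ∈ R → (b, a) ∈ R)
    (hI : ∀ w ∈ I, ∀ w', WordConj w w' → w' ∈ I) :
    FlatLang I (insRules R) = CSSHLang I R := by
  apply Set.Subset.antisymm
  · apply Set.sInter_subset_of_mem
    refine ⟨fun w hw L hL => hL.1 w hw w (wc_refl w), ?_⟩
    rintro _ ⟨_, ⟨a, b, hab, rfl⟩, x, y, z, hu, hv, rfl⟩
    simp only [List.append_nil, List.nil_append] at hu hv ⊢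
    refine cssh_step ⟨a, b, y ++ x, z, hab,
      cssh_conj hu ⟨x ++ [a], y, rfl, by simp⟩, hv, ?_⟩
    exact ⟨x ++ [a] ++ z ++ [b], y, by simp, by simp⟩
  · apply Set.sInter_subset_of_mem
    refine ⟨fun w hw w' hc L hL => hL.1 (hI w hw w' hc), ?_⟩
    rintro w ⟨a, b, x, y, hab, hx, hy, hc⟩
    refine flat_conj hsym hI ?_ (wc_symm hc)
    simpa using flat_ins (x := x) (y := []) hab hx hy

/-- Correspondence between (1,3)-CSSH circular splicing systems and flat splicing
systems with rules `(a,1,1,b)`. First part: for a (1,3)-CSSH system `(A, I, R)` (with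
`R` symmetric), the flat system with initial set `Y = Lin(I)` and rules
`{(a,1,1,b) : (a,b) ∈ R}` generates `Lin(L(S))`. Converse part: if `Y ⊆ A^+` is finite
and closed under conjugacy and `R` is symmetric, then the flat system `(A, Y, R')`
generates the full linearization of the language of the (1,3)-CSSH system
`(A, ~Y, R)`. -/
theorem stmt17 {A : Type} (R : Set (A × A))
    (hsym : ∀ a b : A, (a, b) ∈ R → (b, a) ∈ R) :
    (∀ I : Set (List A), (∀ w ∈ I, ∀ w', WordConj w w' → w' ∈ I) →
        FlatLang I (insRules R) = CSSHLang I R) ∧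
      (∀ Y : Set (List A), Y.Finite → (∀ y ∈ Y, y ≠ []) →
        (∀ w ∈ Y, ∀ w', WordConj w w' → w' ∈ Y) →
        FlatLang Y (insRules R) = CSSHLang Y R) := by
  exact ⟨fun I hI => flat_eq hsym hI, fun Y _ _ hY => flat_eq hsym hY⟩
end

section
/- Let A be a finite alphabet and let Y ⊆ A^+ be a set of nonempty words. Then Y^{←*} \ {1} = L(S'), where S' = (A, Y, R') is the flat splicing system with initial set Y and rule set R' = {(a,1,1,b) : a,b ∈ A}. -/
/-- One insertion step: `w` is obtained from `u` by inserting a word of `Y`. -/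
def InsStep {A : Type*} (Y : Set (List A)) (u w : List A) : Prop :=
  ∃ u1 u2 y : List A, y ∈ Y ∧ u = u1 ++ u2 ∧ w = u1 ++ y ++ u2

/-- The derivation quasi-order `≤_Y`: reflexive-transitive closure of `⇒_Y`. -/
def DerivLE {A : Type*} (Y : Set (List A)) : List A → List A → Prop :=
  Relation.ReflTransGen (InsStep Y)

/-- The pure unitary language of the pure unitary grammar `(A, Y)`:
all words derivable from the empty word. -/
def unitaryLang {A : Type*} (Y : Set (List A)) : Set (List A) :=
  {w | DerivLE Y [] w}

/-- Iterated insertion: `Y^{←0} = {1}` and `Y^{←(i+1)} = Y^{←i} ← Y`. -/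
def iterIns {A : Type*} (Y : Set (List A)) : ℕ → Set (List A)
  | 0 => {[]}
  | i + 1 => {w | ∃ z ∈ iterIns Y i, InsStep Y z w}

/-- `Y^{←*} = ⋃_{i ≥ 0} Y^{←i}`. -/
def iterInsStar {A : Type*} (Y : Set (List A)) : Set (List A) :=
  ⋃ i, iterIns Y i

theorem star_step {A : Type*} {Y : Set (List A)} {u1 u2 y : List A} (hy : y ∈ Y)
    (h : u1 ++ u2 ∈ iterInsStar Y) : u1 ++ y ++ u2 ∈ iterInsStar Y := by
  obtain ⟨i, hi⟩ := Set.mem_iUnion.1 h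
  exact Set.mem_iUnion.2 ⟨i + 1, u1 ++ u2, hi, u1, u2, y, hy, rfl, rfl⟩

theorem star_ins {A : Type*} {Y : Set (List A)} (j : ℕ) : ∀ (x y v : List A),
    v ∈ iterIns Y j → x ++ y ∈ iterInsStar Y → x ++ v ++ y ∈ iterInsStar Y := by
  induction j with
  | zero =>
    intro x y v hv h
    have hv' : v = [] := hv
    subst hv'
    simpa using h
  | succ j ih =>
    rintro x y v ⟨z, hz, v1, v2, t, ht, rfl, rfl⟩ h
    have h1 := ih x y _ hz h
    have h2 : (x ++ v1) ++ (v2 ++ y) ∈ iterInsStar Y := by simpa using h1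
    simpa using star_step ht h2

/-- For a set `Y ⊆ A^+` of nonempty words over a finite alphabet `A`,
`Y^{←*} \ {1}` equals the language generated by the flat splicing system with initial
set `Y` and rules `{(a,1,1,b) : a, b ∈ A}`. -/
theorem stmt18 {A : Type} [Fintype A] (Y : Set (List A))
    (hne : ∀ y ∈ Y, y ≠ []) :
    iterInsStar Y \ {[]} = FlatLang Y (insRules (Set.univ : Set (A × A))) := by
  apply Set.Subset.antisymm
  · rintro w ⟨hw, hw0⟩ L ⟨hY, hL⟩
    have hcl : ∀ x y v : List A, x ≠ [] → v ≠ [] → x ++ y ∈ L → v ∈ L → x ++ v ++ y ∈ L := by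
      intro x y v hx hv hxy hvL
      rcases List.eq_nil_or_concat x with rfl | ⟨x', a, rfl⟩
      · exact absurd rfl hx
      rcases List.eq_nil_or_concat v with rfl | ⟨z, b, rfl⟩
      · exact absurd rfl hv
      apply hL
      refine ⟨⟨[a], [], [], [b]⟩, ⟨a, b, trivial, rfl⟩, x', y, z, ?_, ?_, ?_⟩
      · simpa using hxy
      · simpa using hvL
      · simp
    have key : ∀ i, ∀ w ∈ iterIns Y i, w = [] ∨ w ∈ L := by
      intro i
      induction i with
      | zero => intro w hw; exact Or.inl hw
      | succ i ih =>
        rintro w ⟨z, hz, u1, u2, y, hy, rfl, rfl⟩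
        right
        rcases ih _ hz with h | h
        · obtain ⟨rfl, rfl⟩ := List.append_eq_nil_iff.1 h
          simpa using hY hy
        · by_cases h1 : u1 = []
          · subst h1
            by_cases h2 : u2 = []
            · subst h2
              simpa using hY hy
            · have := hcl y [] u2 (hne y hy) h2 (by simpa using hY hy) (by simpa using h)
              simpa using this
          · exact hcl u1 u2 y h1 (hne y hy) h (hY hy)
    obtain ⟨i, hi⟩ := Set.mem_iUnion.1 hw
    exact (key i w hi).resolve_left hw0
  · intro w hw
    apply hw
    refine ⟨?_, ?_⟩
    · intro y hy
      refine ⟨?_, hne y hy⟩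
      have h0 : ([] : List A) ++ [] ∈ iterInsStar Y := Set.mem_iUnion.2 ⟨0, rfl⟩
      simpa using star_step hy h0
    · rintro w ⟨r, ⟨a, b, -, rfl⟩, x, y, z, hu, hv, rfl⟩
      refine ⟨?_, by simp⟩
      obtain ⟨j, hj⟩ := Set.mem_iUnion.1 hv.1
      have h1 : (x ++ [a]) ++ y ∈ iterInsStar Y := by simpa using hu.1
      simpa using star_ins j _ _ _ hj h1
end
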